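/- arXiv:2507.20773 — 4 statements merged into one kernel-verified Lean document; each statement's English description precedes it below -/
import Mathlib

section
/- Necessity of the smooth strongly convex interpolation conditions: let 0 ≤ μ < L be real numbers and let f : R^d → R be a differentiable function whose gradient is L-Lipschitz and such that x ↦ f(x) − (μ/2)‖x‖² is convex. Then for all x, y ∈ R^d, f(x) − f(y) − ⟨∇f(y), x − y⟩ ≥ (1/(2(1 − μ/L))) · ( (1/L)‖∇f(x) − ∇f(y)‖² + μ‖x − y‖² − (2μ/L)⟨∇f(y) − ∇f(x), y − x⟩ ). -/
open RealInnerProductSpace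

section

variable {E : Type*} [NormedAddCommGroup E] [InnerProductSpace ℝ E] [CompleteSpace E]

lemma hasDerivAt_comp_add_smul {f : E → ℝ} (hf : Differentiable ℝ f) (x v : E) (t : ℝ) :
    HasDerivAt (fun s : ℝ => f (x + s • v)) ⟪gradient f (x + t • v), v⟫ t := by
  have hline : HasDerivAt (fun s : ℝ => x + s • v) v t := by
    simpa using ((hasDerivAt_id t).smul_const v).const_add x
  have h := (hf (x + t • v)).hasFDerivAt.comp_hasDerivAt t hline
  rwa [← inner_gradient_left] at h

/-- The descent lemma. -/
lemma le_add_inner_gradient_add_of_lipschitzWith {f : E → ℝ} {L : NNReal}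
    (hf : Differentiable ℝ f) (hlip : LipschitzWith L (gradient f)) (x v : E) :
    f (x + v) ≤ f x + ⟪gradient f x, v⟫ + L / 2 * ‖v‖ ^ 2 := by
  have hder : ∀ t : ℝ, HasDerivAt
      (fun s : ℝ => s * ⟪gradient f x, v⟫ + L / 2 * ‖v‖ ^ 2 * s ^ 2 - f (x + s • v))
      (⟪gradient f x, v⟫ + L * ‖v‖ ^ 2 * t - ⟪gradient f (x + t • v), v⟫) t := by
    intro t
    have h := (((hasDerivAt_id t).mul_const ⟪gradient f x, v⟫).add
      ((hasDerivAt_pow 2 t).const_mul (L / 2 * ‖v‖ ^ 2))).sub (hasDerivAt_comp_add_smul hf x v t)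
    refine h.congr_deriv ?_
    push_cast
    ring
  have hmono : MonotoneOn
      (fun s : ℝ => s * ⟪gradient f x, v⟫ + L / 2 * ‖v‖ ^ 2 * s ^ 2 - f (x + s • v))
      (Set.Icc 0 1) := by
    refine monotoneOn_of_deriv_nonneg (convex_Icc 0 1)
      (fun t _ => (hder t).continuousAt.continuousWithinAt)
      (fun t _ => (hder t).differentiableAt.differentiableWithinAt) fun t ht => ?_
    rw [interior_Icc] at ht
    rw [(hder t).deriv]
    have hg : ‖gradient f (x + t • v) - gradient f x‖ ≤ L * (t * ‖v‖) := by
      simpa [dist_eq_norm, norm_smul, abs_of_pos ht.1] using hlip.dist_le_mul (x + t • v) x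
    have hcs := real_inner_le_norm (gradient f (x + t • v) - gradient f x) v
    rw [inner_sub_left] at hcs
    have := mul_le_mul_of_nonneg_right hg (norm_nonneg v)
    linarith
  have h := hmono (Set.left_mem_Icc.2 zero_le_one) (Set.right_mem_Icc.2 zero_le_one) zero_le_one
  simp only [zero_smul, one_smul, add_zero] at h
  linarith

lemma add_inner_gradient_add_le_of_convexOn {f : E → ℝ} {μ : ℝ} (hf : Differentiable ℝ f)
    (hconv : ConvexOn ℝ Set.univ (fun x => f x - μ / 2 * ‖x‖ ^ 2)) (y v : E) :
    f y + ⟪gradient f y, v⟫ + μ / 2 * ‖v‖ ^ 2 ≤ f (y + v) := by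
  have hexp : ∀ s : ℝ, ‖y + s • v‖ ^ 2 = ‖y‖ ^ 2 + 2 * ⟪y, v⟫ * s + ‖v‖ ^ 2 * s ^ 2 := by
    intro s
    rw [norm_add_sq_real, inner_smul_right, norm_smul, mul_pow, Real.norm_eq_abs, sq_abs]
    ring
  have hline : ConvexOn ℝ Set.univ (fun s : ℝ => f (y + s • v) - μ / 2 * ‖y + s • v‖ ^ 2) := by
    have h := hconv.comp_affineMap (AffineMap.lineMap y (y + v) : ℝ →ᵃ[ℝ] E)
    simpa [Function.comp_def, AffineMap.lineMap_apply, add_comm] using h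
  have hder : HasDerivAt (fun s : ℝ => f (y + s • v) - μ / 2 * ‖y + s • v‖ ^ 2)
      (⟪gradient f y, v⟫ - μ * ⟪y, v⟫) 0 := by
    simp only [hexp]
    have h := (hasDerivAt_comp_add_smul hf y v 0).sub
      (((((hasDerivAt_id (0 : ℝ)).const_mul (2 * ⟪y, v⟫)).const_add (‖y‖ ^ 2)).add
        ((hasDerivAt_pow 2 (0 : ℝ)).const_mul (‖v‖ ^ 2))).const_mul (μ / 2))
    refine h.congr_deriv ?_
    simp only [zero_smul, add_zero]
    ring
  have h := hline.le_slope_of_hasDerivAt (Set.mem_univ 0) (Set.mem_univ 1) zero_lt_one hder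
  simp only [slope_def_field, hexp, zero_smul, one_smul, add_zero] at h
  linarith

end

/-- Necessity of the smooth strongly convex interpolation conditions
(Taylor–Hendrickx–Glineur). -/
theorem smooth_strongly_convex_interpolation_necessity
    {d : ℕ} (μ L : ℝ) (hμ : 0 ≤ μ) (hμL : μ < L)
    (f : EuclideanSpace ℝ (Fin d) → ℝ)
    (hdiff : Differentiable ℝ f)
    (hlip : LipschitzWith L.toNNReal (gradient f))
    (hconv : ConvexOn ℝ Set.univ (fun x => f x - μ / 2 * ‖x‖ ^ 2)) :
    ∀ x y : EuclideanSpace ℝ (Fin d),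
      f x - f y - ⟪gradient f y, x - y⟫ ≥
        (1 / (2 * (1 - μ / L))) *
          ((1 / L) * ‖gradient f x - gradient f y‖ ^ 2 + μ * ‖x - y‖ ^ 2
            - (2 * μ / L) * ⟪gradient f y - gradient f x, y - x⟫) := by
  intro x y
  have hL : 0 < L := hμ.trans_lt hμL
  have hLμ : 0 < L - μ := sub_pos.2 hμL
  set g := gradient f x - gradient f y with hg
  set v := x - y with hv
  set c := (L - μ)⁻¹ with hc
  -- The upper model at `x` minus the lower model at `y` is minimized at `x - w`.
  set w := c • (g - μ • v) with hw
  have hup := le_add_inner_gradient_add_of_lipschitzWith hdiff hlip x (-w)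
  have hlow := add_inner_gradient_add_le_of_convexOn hdiff hconv y (v - w)
  rw [show y + (v - w) = x + -w by rw [hv]; abel] at hlow
  rw [Real.coe_toNNReal L hL.le, norm_neg, inner_neg_right] at hup
  rw [inner_sub_right, norm_sub_sq_real] at hlow
  have hgw : ⟪gradient f x, w⟫ - ⟪gradient f y, w⟫ = c * (‖g‖ ^ 2 - μ * ⟪g, v⟫) := by
    rw [← inner_sub_left, ← hg, hw, inner_smul_right, inner_sub_right, inner_smul_right,
      real_inner_self_eq_norm_sq]
  have hvw : ⟪v, w⟫ = c * (⟪g, v⟫ - μ * ‖v‖ ^ 2) := by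
    rw [hw, inner_smul_right, inner_sub_right, inner_smul_right, real_inner_self_eq_norm_sq,
      real_inner_comm]
  have hww : ‖w‖ ^ 2 = c ^ 2 * (‖g‖ ^ 2 - 2 * μ * ⟪g, v⟫ + μ ^ 2 * ‖v‖ ^ 2) := by
    rw [hw, norm_smul, mul_pow, norm_sub_sq_real, norm_smul, inner_smul_right, mul_pow,
      Real.norm_eq_abs, Real.norm_eq_abs, sq_abs, sq_abs]
    ring
  have hflip : ⟪gradient f y - gradient f x, y - x⟫ = ⟪g, v⟫ := by
    rw [← neg_sub, ← neg_sub x y, inner_neg_neg]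
  have hrhs : (1 / (2 * (1 - μ / L))) *
      ((1 / L) * ‖g‖ ^ 2 + μ * ‖v‖ ^ 2 - (2 * μ / L) * ⟪g, v⟫) =
      c * (‖g‖ ^ 2 - μ * ⟪g, v⟫) + μ / 2 * (‖v‖ ^ 2 - 2 * ⟪v, w⟫ + ‖w‖ ^ 2)
        - L / 2 * ‖w‖ ^ 2 := by
    rw [hvw, hww, show 1 - μ / L = (L - μ) / L by field_simp, hc]
    field_simp
    ring
  rw [hflip, hrhs]
  linarith
end

section
/- Sufficiency of the smooth strongly convex interpolation conditions: let 0 ≤ μ < L be real numbers, let I be a finite index set, and let {(x_i, g_i, f_i)}_{i∈I} with x_i, g_i ∈ R^d and f_i ∈ R be a finite family of triples such that for every pair i, j ∈ I, f_i − f_j − ⟨g_j, x_i − x_j⟩ ≥ (1/(2(1 − μ/L))) · ( (1/L)‖g_i − g_j‖² + μ‖x_i − x_j‖² − (2μ/L)⟨g_j − g_i, x_j − x_i⟩ ). Then there exists a differentiable function f : R^d → R whose gradient is L-Lipschitz, such that x ↦ f(x) − (μ/2)‖x‖² is convex, and such that f(x_i) = f_i and ∇f(x_i) = g_i for every i ∈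 I. -/
open RealInnerProductSpace

open Filter Topology Asymptotics

section SmoothInterpolation

variable {E : Type*} [NormedAddCommGroup E] [InnerProductSpace ℝ E]

/-- The square norm along a segment. -/
theorem norm_sq_segment (u v : E) (t : ℝ) :
    ‖(1 - t) • u + t • v‖ ^ 2
      = (1 - t) * ‖u‖ ^ 2 + t * ‖v‖ ^ 2 - t * (1 - t) * ‖v - u‖ ^ 2 := by
  simp only [← real_inner_self_eq_norm_sq, inner_add_left, inner_add_right, inner_sub_left,
    inner_sub_right, real_inner_smul_left, real_inner_smul_right, real_inner_comm u v]
  ring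

/-- A continuous convex function with an affine minorant, plus a positive multiple of the square
norm, has a minimizer, around which it grows quadratically. -/
theorem ConvexOn.exists_quadratic_growth [FiniteDimensional ℝ E] {P : E → ℝ}
    (hP : ConvexOn ℝ Set.univ P) (hcont : Continuous P) {a : ℝ} {b : E}
    (hab : ∀ v, a + ⟪b, v⟫ ≤ P v) {c : ℝ} (hc : 0 < c) :
    ∃ u, ∀ v, P u + c * ‖u‖ ^ 2 + c * ‖v - u‖ ^ 2 ≤ P v + c * ‖v‖ ^ 2 := by
  have hreal : Tendsto (fun r : ℝ => r * (c * r - ‖b‖) + a) atTop atTop := by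
    refine tendsto_atTop_add_const_right _ _ (tendsto_id.atTop_mul_atTop₀ ?_)
    exact tendsto_atTop_add_const_right _ (-‖b‖) (tendsto_id.const_mul_atTop hc)
  have hlim : Tendsto (fun v => P v + c * ‖v‖ ^ 2) (cocompact E) atTop := by
    refine tendsto_atTop_mono (fun v => ?_) (hreal.comp (tendsto_norm_cocompact_atTop (E := E)))
    have h1 := hab v
    have h2 := neg_le_of_abs_le (abs_real_inner_le_norm b v)
    simp only [Function.comp_apply]
    nlinarith
  obtain ⟨u, hu⟩ := Continuous.exists_forall_le (by fun_prop) hlim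
  refine ⟨u, fun v => ?_⟩
  have key : ∀ t ∈ Set.Ioo (0 : ℝ) 1,
      P u + c * ‖u‖ ^ 2 + c * (1 - t) * ‖v - u‖ ^ 2 ≤ P v + c * ‖v‖ ^ 2 := by
    rintro t ⟨ht0, ht1⟩
    have h1 := hu ((1 - t) • u + t • v)
    have h2 := hP.2 (Set.mem_univ u) (Set.mem_univ v) (sub_nonneg.2 ht1.le) ht0.le (by ring)
    rw [norm_sq_segment] at h1
    simp only [smul_eq_mul] at h2
    refine le_of_mul_le_mul_left ?_ ht0
    linarith
  have ht : Tendsto (fun t : ℝ => P u + c * ‖u‖ ^ 2 + c * (1 - t) * ‖v - u‖ ^ 2) (𝓝[>] 0)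
      (𝓝 (P u + c * ‖u‖ ^ 2 + c * (1 - 0) * ‖v - u‖ ^ 2)) :=
    (Continuous.tendsto (by fun_prop) 0).mono_left nhdsWithin_le_nhds
  have := le_of_tendsto ht
    (eventually_of_mem (Ioo_mem_nhdsGT one_pos) key)
  simpa using this

/-- A finite family satisfying the smooth convex interpolation inequalities extends to a function
and a vector field on the whole space satisfying the same inequalities. -/
theorem exists_extension_of_interpolation [FiniteDimensional ℝ E] {I : Type*} [Fintype I]
    [Nonempty I] {c : ℝ} (hc : 0 < c) (x g : I → E) (f : I → ℝ)
    (h : ∀ i j, f j + ⟪g j, x i - x j⟫ + c * ‖g i - g j‖ ^ 2 ≤ f i) :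
    ∃ (G : E → ℝ) (u : E → E),
      (∀ y z, G y + ⟪u y, z - y⟫ + c * ‖u z - u y‖ ^ 2 ≤ G z) ∧
        ∀ i, G (x i) = f i ∧ u (x i) = g i := by
  set α : I → E → ℝ := fun i v =>
    ⟪g i, x i⟫ - f i + ⟪x i, v - g i⟫ + c * ‖g i‖ ^ 2 - 2 * c * ⟪g i, v⟫ with hα
  set P : E → ℝ := fun v => Finset.univ.sup' Finset.univ_nonempty (fun i => α i v) with hPdef
  have hαP : ∀ i v, α i v ≤ P v := fun i v =>
    Finset.le_sup' (fun i => α i v) (Finset.mem_univ i)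
  have hPle : ∀ v r, (∀ i, α i v ≤ r) → P v ≤ r := fun v r hr =>
    Finset.sup'_le _ _ fun i _ => hr i
  have hPcont : Continuous P :=
    Continuous.finset_sup'_apply _ fun i _ => by simp only [hα]; fun_prop
  have hPconv : ConvexOn ℝ Set.univ P := by
    refine ⟨convex_univ, fun v _ w _ s t hs ht hst => hPle _ _ fun i => ?_⟩
    have h1 := mul_le_mul_of_nonneg_left (hαP i v) hs
    have h2 := mul_le_mul_of_nonneg_left (hαP i w) ht
    have h3 : α i (s • v + t • w) = s * α i v + t * α i w := by
      obtain rfl : s = 1 - t := by linarith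
      simp only [hα, inner_add_right, inner_sub_right, real_inner_smul_right]
      ring
    simp only [smul_eq_mul]
    linarith
  have hα_add : ∀ i v, α i v + c * ‖v‖ ^ 2
      = ⟪g i, x i⟫ - f i + ⟪x i, v - g i⟫ + c * ‖v - g i‖ ^ 2 := by
    intro i v
    rw [norm_sub_sq_real, real_inner_comm (g i) v]
    simp only [hα]
    ring
  obtain ⟨i₀⟩ := ‹Nonempty I›
  have hmin : ∀ y, ∃ u, ∀ v, (P u - ⟪y, u⟫) + c * ‖u‖ ^ 2 + c * ‖v - u‖ ^ 2
      ≤ (P v - ⟪y, v⟫) + c * ‖v‖ ^ 2 := by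
    intro y
    refine ConvexOn.exists_quadratic_growth (P := fun v => P v - ⟪y, v⟫)
      (a := ⟪g i₀, x i₀⟫ - f i₀ - ⟪x i₀, g i₀⟫ + c * ‖g i₀‖ ^ 2)
      (b := x i₀ - (2 * c) • g i₀ - y) ?_ (by fun_prop) (fun v => ?_) hc
    · exact hPconv.sub ((innerSL ℝ y).toLinearMap.concaveOn convex_univ)
    · have := hαP i₀ v
      simp only [hα, inner_sub_left, inner_sub_right, real_inner_smul_left] at this ⊢
      linarith
  choose u hu using hmin
  refine ⟨fun y => ⟪y, u y⟫ - P (u y) - c * ‖u y‖ ^ 2, u, fun y z => ?_, fun j => ?_⟩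
  · have h1 := hu z (u y)
    rw [norm_sub_rev] at h1
    rw [inner_sub_right, real_inner_comm z, real_inner_comm y]
    linarith
  · have h1 : P (g j) + c * ‖g j‖ ^ 2 ≤ ⟪g j, x j⟫ - f j := by
      have := hPle (g j) (⟪g j, x j⟫ - f j - c * ‖g j‖ ^ 2) fun i => by
        have h2 := hα_add i (g j)
        have h3 := h i j
        rw [norm_sub_rev] at h3
        rw [inner_sub_right] at h2 h3
        rw [real_inner_comm (g i), real_inner_comm (g j)] at h2
        linarith
      linarith
    have h2 := hu (x j) (g j)
    have h3 := hαP j (u (x j))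
    have h4 := hα_add j (u (x j))
    rw [inner_sub_right, real_inner_comm (g j)] at h4
    rw [norm_sub_rev, real_inner_comm (g j)] at h2
    have h5 : c * ‖u (x j) - g j‖ ^ 2 ≤ 0 := by linarith
    have h6 : ‖u (x j) - g j‖ ^ 2 = 0 := by
      have := sq_nonneg ‖u (x j) - g j‖
      nlinarith
    have h7 : u (x j) = g j := by simpa [sub_eq_zero] using h6
    refine ⟨?_, h7⟩
    rw [h6] at h2 h4
    rw [h7] at h2 h3 h4
    have h8 := real_inner_comm (g j) (x j)
    simp only [h7]
    linarith

end SmoothInterpolation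

/-- Sufficiency of the smooth strongly convex interpolation conditions
(Taylor–Hendrickx–Glineur). -/
theorem smooth_strongly_convex_interpolation_sufficiency
    {d : ℕ} {I : Type*} [Fintype I] (μ L : ℝ) (hμ : 0 ≤ μ) (hμL : μ < L)
    (x g : I → EuclideanSpace ℝ (Fin d)) (f : I → ℝ)
    (h : ∀ i j : I,
      f i - f j - ⟪g j, x i - x j⟫ ≥
        (1 / (2 * (1 - μ / L))) *
          ((1 / L) * ‖g i - g j‖ ^ 2 + μ * ‖x i - x j‖ ^ 2
            - (2 * μ / L) * ⟪g j - g i, x j - x i⟫)) :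
    ∃ F : EuclideanSpace ℝ (Fin d) → ℝ,
      Differentiable ℝ F ∧
      LipschitzWith L.toNNReal (gradient F) ∧
      ConvexOn ℝ Set.univ (fun y => F y - μ / 2 * ‖y‖ ^ 2) ∧
      ∀ i : I, F (x i) = f i ∧ gradient F (x i) = g i := by
  have hL : 0 < L := hμ.trans_lt hμL
  have hM : 0 < L - μ := sub_pos.2 hμL
  set c : ℝ := 1 / (2 * (L - μ)) with hcdef
  have hc : 0 < c := by positivity
  have hcM : c * (L - μ) = 1 / 2 := by rw [hcdef]; field_simp
  obtain ⟨G, u, hG, hGi⟩ : ∃ (G : EuclideanSpace ℝ (Fin d) → ℝ)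
      (u : EuclideanSpace ℝ (Fin d) → EuclideanSpace ℝ (Fin d)),
      (∀ y z, G y + ⟪u y, z - y⟫ + c * ‖u z - u y‖ ^ 2 ≤ G z) ∧
        ∀ i, G (x i) = f i - μ / 2 * ‖x i‖ ^ 2 ∧ u (x i) = g i - μ • x i := by
    cases isEmpty_or_nonempty I
    · exact ⟨0, 0, by simp, fun i => isEmptyElim i⟩
    refine exists_extension_of_interpolation hc x (fun i => g i - μ • x i)
      (fun i => f i - μ / 2 * ‖x i‖ ^ 2) fun i j => ?_
    have hij := h i j
    have e1 : g i - μ • x i - (g j - μ • x j) = (g i - g j) - μ • (x i - x j) := by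
      rw [smul_sub]; abel
    have e2 : ⟪g j - g i, x j - x i⟫ = ⟪g i - g j, x i - x j⟫ := by
      rw [← neg_sub (g i), ← neg_sub (x i), inner_neg_neg]
    have e3 : 1 / (2 * (1 - μ / L)) * ((1 / L) * ‖g i - g j‖ ^ 2 + μ * ‖x i - x j‖ ^ 2
        - (2 * μ / L) * ⟪g i - g j, x i - x j⟫) = c * (‖g i - g j‖ ^ 2
          + μ * L * ‖x i - x j‖ ^ 2 - 2 * μ * ⟪g i - g j, x i - x j⟫) := by
      have : 1 - μ / L = (L - μ) / L := by field_simp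
      rw [this, hcdef]
      field_simp
    have e4 : ‖x i‖ ^ 2 = ‖x j‖ ^ 2 + 2 * ⟪x j, x i - x j⟫ + ‖x i - x j‖ ^ 2 := by
      rw [← norm_add_sq_real, add_sub_cancel]
    have e5 : c * (μ * L * ‖x i - x j‖ ^ 2)
        = c * (μ ^ 2 * ‖x i - x j‖ ^ 2) + μ / 2 * ‖x i - x j‖ ^ 2 := by
      linear_combination (μ * ‖x i - x j‖ ^ 2) * hcM
    rw [e2, e3] at hij
    rw [e1, norm_sub_sq_real (g i - g j), real_inner_smul_right, norm_smul, mul_pow,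
      Real.norm_eq_abs, sq_abs, e4, inner_sub_left, real_inner_smul_left]
    linarith
  have hco : ∀ y z, ‖u z - u y‖ ^ 2 ≤ (L - μ) * ⟪u z - u y, z - y⟫ := by
    intro y z
    have h1 := hG y z
    have h2 := hG z y
    rw [norm_sub_rev, ← neg_sub z y, inner_neg_right] at h2
    rw [inner_sub_left]
    have h3 : 2 * c * ‖u z - u y‖ ^ 2 ≤ ⟪u z, z - y⟫ - ⟪u y, z - y⟫ := by linarith
    have h4 := mul_le_mul_of_nonneg_left h3 hM.le
    calc ‖u z - u y‖ ^ 2 = (L - μ) * (2 * c * ‖u z - u y‖ ^ 2) := by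
          linear_combination (-2 * ‖u z - u y‖ ^ 2) * hcM
      _ ≤ _ := h4
  have hulip : ∀ y z, ‖u z - u y‖ ≤ (L - μ) * ‖z - y‖ := by
    intro y z
    rcases (norm_nonneg (u z - u y)).eq_or_lt with h0 | h0
    · rw [← h0]; positivity
    refine le_of_mul_le_mul_left ?_ h0
    have h1 := hco y z
    have h2 := mul_le_mul_of_nonneg_left (real_inner_le_norm (u z - u y) (z - y)) hM.le
    linarith
  have hinner : ∀ y z, ⟪u z - u y, z - y⟫ ≤ (L - μ) * ‖z - y‖ ^ 2 := fun y z => by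
    have h1 := real_inner_le_norm (u z - u y) (z - y)
    have h2 := mul_le_mul_of_nonneg_right (hulip y z) (norm_nonneg (z - y))
    linarith
  have hgradG : ∀ y, HasGradientAt G (u y) y := by
    intro y
    rw [hasGradientAt_iff_isLittleO]
    refine IsBigO.trans_isLittleO (IsBigO.of_bound (L - μ) (Eventually.of_forall fun z => ?_))
      (isLittleO_pow_sub_sub y one_lt_two)
    have h1 := hG y z
    have h2 := hG z y
    have h3 := hinner y z
    rw [← neg_sub z y, inner_neg_right] at h2
    rw [inner_sub_left] at h3
    have h4 : 0 ≤ c * ‖u z - u y‖ ^ 2 := by positivity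
    have h5 : 0 ≤ c * ‖u y - u z‖ ^ 2 := by positivity
    rw [Real.norm_eq_abs, Real.norm_of_nonneg (by positivity), abs_le]
    have h6 : 0 ≤ (L - μ) * ‖z - y‖ ^ 2 := by positivity
    constructor <;> linarith
  have hgradF : ∀ y, HasGradientAt (fun y => G y + μ / 2 * ‖y‖ ^ 2) (u y + μ • y) y := by
    intro y
    rw [hasGradientAt_iff_hasFDerivAt]
    refine ((hgradG y).hasFDerivAt.add
      ((hasStrictFDerivAt_norm_sq y).hasFDerivAt.const_mul (μ / 2))).congr_fderiv ?_
    ext z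
    simp
    ring
  have hgrad : gradient (fun y => G y + μ / 2 * ‖y‖ ^ 2) = fun y => u y + μ • y :=
    funext fun y => (hgradF y).gradient
  refine ⟨fun y => G y + μ / 2 * ‖y‖ ^ 2, fun y => (hgradF y).differentiableAt, ?_, ?_,
    fun i => ⟨by simp [(hGi i).1], by simp [hgrad, (hGi i).2]⟩⟩
  · rw [hgrad]
    refine LipschitzWith.of_dist_le_mul fun z y => ?_
    rw [dist_eq_norm, dist_eq_norm, Real.coe_toNNReal L hL.le]
    have e : u z + μ • z - (u y + μ • y) = (u z - u y) + μ • (z - y) := by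
      rw [smul_sub]; abel
    rw [e]
    calc _ ≤ ‖u z - u y‖ + ‖μ • (z - y)‖ := norm_add_le _ _
      _ ≤ (L - μ) * ‖z - y‖ + μ * ‖z - y‖ := by
        rw [norm_smul, Real.norm_of_nonneg hμ]
        gcongr
        exact hulip y z
      _ = L * ‖z - y‖ := by ring
  · simp only [add_sub_cancel_right]
    refine ⟨convex_univ, fun y _ z _ s t hs ht hst => ?_⟩
    set w := s • y + t • z with hw
    have h0 : ∀ p, G w + ⟪u w, p - w⟫ ≤ G p := fun p =>
      le_trans (le_add_of_nonneg_right (by positivity)) (hG w p)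
    have h1 := mul_le_mul_of_nonneg_left (h0 y) hs
    have h2 := mul_le_mul_of_nonneg_left (h0 z) ht
    have h3 : s * ⟪u w, y - w⟫ + t * ⟪u w, z - w⟫ = 0 := by
      have : s • (y - w) + t • (z - w) = 0 := by
        rw [smul_sub, smul_sub, sub_add_sub_comm, ← add_smul, hst, one_smul, ← hw, sub_self]
      rw [← real_inner_smul_right, ← real_inner_smul_right, ← inner_add_right, this,
        inner_zero_right]
    simp only [smul_eq_mul]
    have h4 : s * G w + t * G w = G w := by rw [← add_mul, hst, one_mul]
    linarith
end

section
/- Convergence of inexact gradient descent with relative inexactness: let L > 0, let f : R^d → R be convex and differentiable with L-Lipschitz gradient, attaining its minimum at some x* ∈ R^d. Let ε ∈ (0,1), let h ∈ (0, 3/(2(1+ε))], and let x_0, x_1, …, x_N ∈ R^d and d_0, …, d_{N−1} ∈ R^d satisfy ‖d_k − ∇f(x_k)‖ ≤ ε‖∇f(x_k)‖ and x_{k+1} = x_k − (h/L) d_k for k = 0, …, N−1. Then (1/L) · min_{k ∈ {1,…,N}} ‖∇f(x_k)‖² ≤ (f(x_0) − f(x*)) / (1/2 + N h (1 − ε)).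 -/
section SmoothConvex

variable {E : Type*} [NormedAddCommGroup E] [InnerProductSpace ℝ E] [CompleteSpace E]
  {f : E → ℝ} {L : ℝ}

/-- The derivative of a differentiable function along a line, in terms of its gradient. -/
lemma hasDerivAt_comp_line_of_differentiable (hf : Differentiable ℝ f) (x v : E) (t : ℝ) :
    HasDerivAt (fun s : ℝ => f (x + s • v)) (inner ℝ (gradient f (x + t • v)) v) t := by
  have hline : HasDerivAt (fun s : ℝ => x + s • v) v t := by
    simpa using ((hasDerivAt_id t).smul_const v).const_add x
  exact (hf (x + t • v)).hasGradientAt.hasFDerivAt.comp_hasDerivAt t hline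

/-- A differentiable convex function lies above its tangent planes. -/
lemma ConvexOn.add_inner_gradient_le (hc : ConvexOn ℝ Set.univ f) (hf : Differentiable ℝ f)
    (x y : E) : f x + inner ℝ (gradient f x) (y - x) ≤ f y := by
  have hline : ConvexOn ℝ Set.univ (fun t : ℝ => f (x + t • (y - x))) := by
    have := hc.comp_affineMap (AffineMap.lineMap x y : ℝ →ᵃ[ℝ] E)
    simpa [Function.comp_def, AffineMap.lineMap_apply, add_comm] using this
  have hslope := hline.le_slope_of_hasDerivAt (Set.mem_univ 0) (Set.mem_univ 1) one_pos
    (hasDerivAt_comp_line_of_differentiable hf x (y - x) 0)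
  simp only [slope_def_field, zero_smul, one_smul, add_zero, sub_zero, div_one,
    add_sub_cancel] at hslope
  linarith

/-- The quadratic upper bound for functions with Lipschitz gradient. -/
lemma LipschitzWith.le_add_inner_gradient_add (hL : 0 ≤ L) (hf : Differentiable ℝ f)
    (hlip : LipschitzWith L.toNNReal (gradient f)) (x y : E) :
    f y ≤ f x + inner ℝ (gradient f x) (y - x) + L / 2 * ‖y - x‖ ^ 2 := by
  set v := y - x with hv
  have hB (t : ℝ) : HasDerivAt
      (fun t : ℝ => f x + t * inner ℝ (gradient f x) v + L / 2 * ‖v‖ ^ 2 * t ^ 2)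
      (inner ℝ (gradient f x) v + L * t * ‖v‖ ^ 2) t := by
    refine ((((hasDerivAt_id t).mul_const (inner ℝ (gradient f x) v)).const_add (f x)).add
      ((hasDerivAt_pow 2 t).const_mul (L / 2 * ‖v‖ ^ 2))).congr_deriv ?_
    norm_num
    ring
  have hbound := image_le_of_deriv_right_le_deriv_boundary (a := 0) (b := 1)
    (fun t _ =>
      (hasDerivAt_comp_line_of_differentiable hf x v t).continuousAt.continuousWithinAt)
    (fun t _ => (hasDerivAt_comp_line_of_differentiable hf x v t).hasDerivWithinAt)
    (by simp) (fun t _ => (hB t).continuousAt.continuousWithinAt)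
    (fun t _ => (hB t).hasDerivWithinAt)
    (fun t ht => by
      have hnorm : ‖gradient f (x + t • v) - gradient f x‖ ≤ L * (t * ‖v‖) := by
        simpa [norm_smul, abs_of_nonneg ht.1, Real.coe_toNNReal L hL] using
          hlip.norm_sub_le (x + t • v) x
      have hinner := real_inner_le_norm (gradient f (x + t • v) - gradient f x) v
      rw [inner_sub_left] at hinner
      nlinarith [mul_le_mul_of_nonneg_right hnorm (norm_nonneg v)])
    (Set.right_mem_Icc.mpr zero_le_one)
  simpa [hv] using hbound

/-- The interpolation inequality for smooth convex functions. -/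
lemma ConvexOn.add_inner_gradient_add_sq_le (hL : 0 < L) (hc : ConvexOn ℝ Set.univ f)
    (hf : Differentiable ℝ f) (hlip : LipschitzWith L.toNNReal (gradient f)) (x y : E) :
    f y + inner ℝ (gradient f y) (x - y) + 1 / (2 * L) * ‖gradient f x - gradient f y‖ ^ 2
      ≤ f x := by
  set u := gradient f x - gradient f y with hu
  have hlower := hc.add_inner_gradient_le hf y (x - (1 / L) • u)
  have hupper := hlip.le_add_inner_gradient_add hL.le hf x (x - (1 / L) • u)
  have hsq : inner ℝ (gradient f x) u - inner ℝ (gradient f y) u = ‖u‖ ^ 2 := by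
    rw [← inner_sub_left, ← hu, real_inner_self_eq_norm_sq]
  have hz : x - (1 / L) • u - x = -((1 / L) • u) := by abel
  have hz' : x - (1 / L) • u - y = (x - y) - (1 / L) • u := by abel
  rw [hz', inner_sub_right, real_inner_smul_right] at hlower
  rw [hz, inner_neg_right, real_inner_smul_right, norm_neg, norm_smul, mul_pow,
    Real.norm_eq_abs, sq_abs] at hupper
  have hcoef : L / 2 * ((1 / L) ^ 2 * ‖u‖ ^ 2) = 1 / L * ‖u‖ ^ 2 - 1 / (2 * L) * ‖u‖ ^ 2 := by
    field_simp
    ring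
  rw [hcoef, ← hsq] at hupper
  rw [← hsq]
  linarith

/-- One step of inexact gradient descent decreases a smooth convex function by a multiple of the
squared norm of the gradient at the new point. -/
lemma ConvexOn.mul_norm_gradient_sq_le_of_inexact_step (hL : 0 < L)
    (hc : ConvexOn ℝ Set.univ f) (hf : Differentiable ℝ f)
    (hlip : LipschitzWith L.toNNReal (gradient f)) {ε h : ℝ} (hε : 0 ≤ ε) (hh : 0 ≤ h)
    (hh' : h * (1 + ε) ≤ 3 / 2) {x y d : E} (hd : ‖d - gradient f x‖ ≤ ε * ‖gradient f x‖)
    (hy : y = x - (h / L) • d) :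
    h * (1 - ε) * ‖gradient f y‖ ^ 2 ≤ L * (f x - f y) := by
  have hxy := hc.add_inner_gradient_add_sq_le hL hf hlip x y
  have hyx := hc.add_inner_gradient_add_sq_le hL hf hlip y x
  have hstep : x - y = (h / L) • d := by rw [hy]; abel
  have hstep' : y - x = -((h / L) • d) := by rw [← hstep]; abel
  rw [hstep, real_inner_smul_right] at hxy
  rw [hstep', inner_neg_right, real_inner_smul_right, norm_sub_rev] at hyx
  set a := gradient f x
  set b := gradient f y
  obtain ⟨e, rfl⟩ : ∃ e, d = a + e := ⟨d - a, by abel⟩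
  rw [add_sub_cancel_left] at hd
  have hU : ‖a - b‖ ^ 2 = ‖a‖ ^ 2 - 2 * inner ℝ a b + ‖b‖ ^ 2 := norm_sub_sq_real a b
  have hV : ‖(2 : ℝ) • b - a‖ ^ 2 = 4 * ‖b‖ ^ 2 - 4 * inner ℝ a b + ‖a‖ ^ 2 := by
    rw [norm_sub_sq_real, norm_smul, real_inner_smul_left, real_inner_comm]
    norm_num
    ring
  have hcs := neg_le_of_abs_le (abs_real_inner_le_norm e ((2 : ℝ) • b - a))
  rw [inner_sub_right, real_inner_smul_right] at hcs
  have herr : 0 ≤ ε * ‖a - b‖ ^ 2 + ε * ‖b‖ ^ 2 + 2 * inner ℝ e b - inner ℝ e a := by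
    have hmul := mul_le_mul_of_nonneg_right hd (norm_nonneg ((2 : ℝ) • b - a))
    have hamgm := mul_nonneg hε (sq_nonneg (‖a‖ - ‖(2 : ℝ) • b - a‖))
    nlinarith
  rw [inner_add_right, real_inner_comm a b] at hxy
  rw [inner_add_right, real_inner_self_eq_norm_sq] at hyx
  rw [real_inner_comm e b] at hxy
  rw [real_inner_comm e a] at hyx
  have hxy' := mul_le_mul_of_nonneg_left hxy hL.le
  have hyx' := mul_le_mul_of_nonneg_left hyx hL.le
  field_simp at hxy' hyx'
  have hslack := mul_nonneg (sub_nonneg.mpr hh') (sq_nonneg ‖a - b‖)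
  have herr' := mul_nonneg hh herr
  rw [hU] at *
  nlinarith

end SmoothConvex

/-- Convergence of inexact gradient descent with relative inexactness
(Vernimmen et al., Theorem 2.3). -/
theorem inexact_gradient_descent_min_grad_norm
    {dim : ℕ} (L : ℝ) (hL : 0 < L)
    (f : EuclideanSpace ℝ (Fin dim) → ℝ)
    (hconv : ConvexOn ℝ Set.univ f)
    (hdiff : Differentiable ℝ f)
    (hlip : LipschitzWith L.toNNReal (gradient f))
    (xstar : EuclideanSpace ℝ (Fin dim)) (hmin : ∀ y, f xstar ≤ f y)
    (ε : ℝ) (hε0 : 0 < ε) (hε1 : ε < 1)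
    (h : ℝ) (hh0 : 0 < h) (hh1 : h ≤ 3 / (2 * (1 + ε)))
    (N : ℕ) (hN : 1 ≤ N)
    (x : ℕ → EuclideanSpace ℝ (Fin dim)) (d : ℕ → EuclideanSpace ℝ (Fin dim))
    (hd : ∀ k < N, ‖d k - gradient f (x k)‖ ≤ ε * ‖gradient f (x k)‖)
    (hx : ∀ k < N, x (k + 1) = x k - (h / L) • d k) :
    (1 / L) * (Finset.Icc 1 N).inf' (Finset.nonempty_Icc.mpr hN)
        (fun k => ‖gradient f (x k)‖ ^ 2) ≤
      (f (x 0) - f xstar) / (1 / 2 + N * h * (1 - ε)) := by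
  set m := (Finset.Icc 1 N).inf' (Finset.nonempty_Icc.mpr hN)
    (fun k => ‖gradient f (x k)‖ ^ 2) with hm
  have hle (k : ℕ) (hk : 1 ≤ k) (hkN : k ≤ N) : m ≤ ‖gradient f (x k)‖ ^ 2 :=
    Finset.inf'_le _ (Finset.mem_Icc.mpr ⟨hk, hkN⟩)
  have hh' : h * (1 + ε) ≤ 3 / 2 := by
    rw [le_div_iff₀ (by positivity)] at hh1
    linarith
  have hrate : 0 ≤ h * (1 - ε) := mul_nonneg hh0.le (by linarith)
  have hsum (k : ℕ) (hk : k ≤ N) : k * (h * (1 - ε) * m) ≤ L * (f (x 0) - f (x k)) := by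
    induction k with
    | zero => simp
    | succ k ih =>
      have hstep := hconv.mul_norm_gradient_sq_le_of_inexact_step hL hdiff hlip hε0.le hh0.le hh'
        (hd k hk) (hx k hk)
      have hmul := mul_le_mul_of_nonneg_left (hle (k + 1) (by omega) hk) hrate
      have := ih (by omega)
      push_cast
      linarith
  have hgrad : gradient f xstar = 0 := by
    have hloc : IsLocalMin f xstar := Filter.Eventually.of_forall hmin
    simp [gradient, hloc.fderiv_eq_zero]
  have hlast := hconv.add_inner_gradient_add_sq_le hL hdiff hlip (x N) xstar
  rw [hgrad, inner_zero_left, sub_zero, add_zero] at hlast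
  have hlast' : 1 / 2 * ‖gradient f (x N)‖ ^ 2 ≤ L * (f (x N) - f xstar) := by
    have := mul_le_mul_of_nonneg_left hlast hL.le
    field_simp at this
    linarith
  have hpos : 0 < 1 / 2 + N * h * (1 - ε) := by
    have : 0 ≤ N * (h * (1 - ε)) := mul_nonneg N.cast_nonneg hrate
    linarith
  rw [le_div_iff₀ hpos, one_div_mul_eq_div, div_mul_eq_mul_div, div_le_iff₀ hL]
  linarith [hsum N le_rfl, hle N hN le_rfl]
end

section
/- Primal solutions give subgradients of the perturbed dual PEP value function: in the setting of the perturbed dual value function φ, let additionally C be a real symmetric n×n matrix with M_0 = −C, let u_i ∈ R^m and μ_i ∈ R for i ∈ I with c_{i,j} = μ_j u_j − μ_i u_i, and suppose (F*, G*) with F* ∈ R^m and G* symmetric positive semidefinite satisfies the primal constraints (F*)ᵀ(μ_i u_i − μ_j u_j) ≥ Tr(A_{i,j} G*) for all i, j ∈ I and Tr(A_R G*) ≤ R², and attains strong duality at B = 0, i.e. φ(0) = bᵀF* + Tr(C G*). Then for every real symmetric n×n matrix B, φ(B) ≥ φ(0) + Tr((−G*) B); that is, −G* is a subgradient of φ at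 B = 0. -/
open Matrix

open scoped MatrixOrder in
/-- The trace of a product of two positive semidefinite real matrices is nonnegative. -/
theorem Matrix.PosSemidef.trace_mul_nonneg_real {ι : Type*} [Fintype ι]
    {M G : Matrix ι ι ℝ} (hM : M.PosSemidef) (hG : G.PosSemidef) : 0 ≤ (M * G).trace := by
  classical
  obtain ⟨D, rfl⟩ := CStarAlgebra.nonneg_iff_eq_star_mul_self.mp hG.nonneg
  rw [star_eq_conjTranspose, ← Matrix.mul_assoc, Matrix.trace_mul_comm, ← Matrix.mul_assoc]
  exact (hM.mul_mul_conjTranspose_same D).trace_nonneg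

/-- Weak duality for the perturbed performance estimation problem. -/
theorem perturbed_pep_weak_duality {n m I : Type*} [Fintype n] [Fintype m] [Fintype I]
    {A_R C B G : Matrix n n ℝ} {A : I → I → Matrix n n ℝ} {b F : m → ℝ} {u : I → m → ℝ}
    {μ : I → ℝ} {r τ : ℝ} {lam : I → I → ℝ} (hG : G.PosSemidef)
    (hprimal : ∀ i j, (A i j * G).trace ≤ F ⬝ᵥ (μ i • u i - μ j • u j))
    (hinit : (A_R * G).trace ≤ r) (hτ : 0 ≤ τ) (hlam : ∀ i j, 0 ≤ lam i j)
    (hpsd : (τ • A_R + (-C) + ∑ i, ∑ j, lam i j • A i j + B).PosSemidef)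
    (hb : b = ∑ i, ∑ j, lam i j • (μ j • u j - μ i • u i)) :
    b ⬝ᵥ F + (C * G).trace + (-G * B).trace ≤ τ * r := by
  have hnonneg := hpsd.trace_mul_nonneg_real hG
  simp only [Matrix.add_mul, Matrix.neg_mul, Matrix.sum_mul, Matrix.smul_mul, Matrix.trace_add,
    Matrix.trace_neg, Matrix.trace_sum, Matrix.trace_smul, smul_eq_mul] at hnonneg
  have hsum : ∑ i, ∑ j, lam i j * (A i j * G).trace ≤ -(b ⬝ᵥ F) := by
    have hbF : -(b ⬝ᵥ F) = ∑ i, ∑ j, lam i j * (F ⬝ᵥ (μ i • u i - μ j • u j)) := by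
      simp only [hb, dotProduct_comm _ F, dotProduct_sum, dotProduct_smul, smul_eq_mul,
        ← Finset.sum_neg_distrib, dotProduct_sub]
      exact Finset.sum_congr rfl fun i _ => Finset.sum_congr rfl fun j _ => by ring
    rw [hbF]
    gcongr with i _ j _
    · exact hlam i j
    · exact hprimal i j
  have hR := mul_le_mul_of_nonneg_left hinit hτ
  rw [Matrix.neg_mul, Matrix.trace_neg, Matrix.trace_mul_comm G B]
  linarith

/-- Primal solutions attaining strong duality give subgradients of the
perturbed dual PEP value function at `B = 0`. -/
theorem perturbed_dual_pep_subgradient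
    {n m : ℕ} {I : Type*} [Fintype I]
    (A_R C : Matrix (Fin n) (Fin n) ℝ) (hAR : A_R.IsSymm) (hC : C.IsSymm)
    (A : I → I → Matrix (Fin n) (Fin n) ℝ) (hA : ∀ i j, (A i j).IsSymm)
    (b : Fin m → ℝ) (u : I → Fin m → ℝ) (μ : I → ℝ) (R : ℝ) (hR : 0 ≤ R)
    (φ : Matrix (Fin n) (Fin n) ℝ → EReal)
    (hφ : ∀ B, φ B = sInf {val : EReal | ∃ (τ : ℝ) (lam : I → I → ℝ),
        0 ≤ τ ∧ (∀ i j, 0 ≤ lam i j) ∧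
        (τ • A_R + (-C) + ∑ i, ∑ j, lam i j • A i j + B).PosSemidef ∧
        b = ∑ i, ∑ j, lam i j • (μ j • u j - μ i • u i) ∧
        val = ((τ * R ^ 2 : ℝ) : EReal)})
    (Fstar : Fin m → ℝ) (Gstar : Matrix (Fin n) (Fin n) ℝ)
    (hGstar : Gstar.PosSemidef)
    (hprimal : ∀ i j, (A i j * Gstar).trace ≤ Fstar ⬝ᵥ (μ i • u i - μ j • u j))
    (hinit : (A_R * Gstar).trace ≤ R ^ 2)
    (hstrong : φ 0 = ((b ⬝ᵥ Fstar + (C * Gstar).trace : ℝ) : EReal)) :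
    ∀ B : Matrix (Fin n) (Fin n) ℝ, B.IsSymm →
      φ B ≥ φ 0 + ((((-Gstar) * B).trace : ℝ) : EReal) := by
  intro B _
  rw [ge_iff_le, hstrong, hφ B]
  refine le_sInf ?_
  rintro _ ⟨τ, lam, hτ, hlam, hpsd, hb, rfl⟩
  exact_mod_cast perturbed_pep_weak_duality hGstar hprimal hinit hτ hlam hpsd hb
end
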